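/- Let H be a smooth 3-form on ℝ^d (smooth functions H_{ijk}, totally antisymmetric). The H-twisted Dorfman bracket on generalized vector fields satisfies the Leibniz identity e₁ ∘ (e₂ ∘ e₃) = (e₁ ∘ e₂) ∘ e₃ + e₂ ∘ (e₁ ∘ e₃) for all generalized vector fields e₁, e₂, e₃ if and only if H is closed, i.e. ∂_i H_{jkl} − ∂_j H_{ikl} + ∂_k H_{ijl} − ∂_l H_{ijk} = 0 for all i, j, k, l and all x ∈ ℝ^d. (This is the first Courant algebroid axiom for the H-twisted standard Courant algebroid on ℝ^d.) -/

import Mathlib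

/-- Partial derivative of a scalar function on `ℝ^d` along the `m`-th coordinate. -/
noncomputable def pd {d : ℕ} (m : Fin d) (f : (Fin d → ℝ) → ℝ) (x : Fin d → ℝ) : ℝ :=
  fderiv ℝ f x (Pi.single m 1)

/-- A generalized vector field on `ℝ^d`: a pair `(X, α)` of a vector field and a 1-form. -/
abbrev GVF (d : ℕ) := ((Fin d → ℝ) → Fin d → ℝ) × ((Fin d → ℝ) → Fin d → ℝ)

/-- The `H`-twisted Dorfman bracket of generalized vector fields. -/
noncomputable def dorfman {d : ℕ} (H : Fin d → Fin d → Fin d → (Fin d → ℝ) → ℝ)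
    (e₁ e₂ : GVF d) : GVF d :=
  (fun x i => ∑ j, (e₁.1 x j * pd j (fun y => e₂.1 y i) x
      - e₂.1 x j * pd j (fun y => e₁.1 y i) x),
   fun x i => (∑ j, (e₁.1 x j * pd j (fun y => e₂.2 y i) x
        + e₂.2 x j * pd i (fun y => e₁.1 y j) x
        - e₂.1 x j * pd j (fun y => e₁.2 y i) x
        + e₂.1 x j * pd i (fun y => e₁.2 y j) x))
      + ∑ j, ∑ k, H i j k x * e₁.1 x j * e₂.1 x k)

section Auxiliary

set_option maxSynthPendingDepth 3

open ContinuousLinearMap in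
/-- The trilinear form on `ℝ^d` with coefficients `H · · · x`. -/
noncomputable def formOfCoeff {d : ℕ} (H : Fin d → Fin d → Fin d → (Fin d → ℝ) → ℝ)
    (x : Fin d → ℝ) : (Fin d → ℝ) →L[ℝ] (Fin d → ℝ) →L[ℝ] (Fin d → ℝ) →L[ℝ] ℝ :=
  ∑ i, ∑ j, ∑ k, H i j k x • (proj (R := ℝ) (φ := fun _ : Fin d => ℝ) i).smulRight
    ((proj (R := ℝ) (φ := fun _ : Fin d => ℝ) j).smulRight
      (proj (R := ℝ) (φ := fun _ : Fin d => ℝ) k))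

open ContinuousLinearMap in
/-- The pairing of covectors and vectors on `ℝ^d`. -/
noncomputable def dotCLM (d : ℕ) : (Fin d → ℝ) →L[ℝ] (Fin d → ℝ) →L[ℝ] ℝ :=
  ∑ i, (proj (R := ℝ) (φ := fun _ : Fin d => ℝ) i).smulRight
    (proj (R := ℝ) (φ := fun _ : Fin d => ℝ) i)

lemma dotCLM_apply {d : ℕ} (a v : Fin d → ℝ) : dotCLM d a v = ∑ i, a i * v i := by
  simp [dotCLM]

lemma dotCLM_single {d : ℕ} (a : Fin d → ℝ) (i : Fin d) : dotCLM d a (Pi.single i 1) = a i := by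
  simp [dotCLM_apply, Pi.single_apply]

lemma formOfCoeff_apply {d : ℕ} (H : Fin d → Fin d → Fin d → (Fin d → ℝ) → ℝ)
    (x u v w : Fin d → ℝ) :
    formOfCoeff H x u v w = ∑ i, ∑ j, ∑ k, H i j k x * (u i * (v j * w k)) := by
  simp [formOfCoeff]

lemma fderiv_apply_eq_sum_pd {d : ℕ} (f : (Fin d → ℝ) → ℝ) (x v : Fin d → ℝ) :
    fderiv ℝ f x v = ∑ j, v j * pd j f x := by
  conv_lhs => rw [pi_eq_sum_univ' v]
  simp [pd, map_sum]

lemma fderiv_coord {d : ℕ} {X : (Fin d → ℝ) → Fin d → ℝ} {x : Fin d → ℝ}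
    (hX : DifferentiableAt ℝ X x) (v : Fin d → ℝ) (i : Fin d) :
    fderiv ℝ X x v i = ∑ j, v j * pd j (fun y => X y i) x := by
  rw [← fderiv_apply_eq_sum_pd, (hasFDerivAt_pi'.1 hX.hasFDerivAt i).fderiv]
  rfl

lemma contDiff_formOfCoeff {d : ℕ} {H : Fin d → Fin d → Fin d → (Fin d → ℝ) → ℝ} {n : WithTop ℕ∞}
    (hH : ∀ i j k, ContDiff ℝ n (H i j k)) : ContDiff ℝ n (formOfCoeff H) := by
  unfold formOfCoeff
  exact ContDiff.sum fun i _ => ContDiff.sum fun j _ => ContDiff.sum fun k _ =>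
    (hH i j k).smul contDiff_const

lemma fderiv_apply₃ {E : Type*} [NormedAddCommGroup E] [NormedSpace ℝ E]
    {T : E → E →L[ℝ] E →L[ℝ] E →L[ℝ] ℝ} {x : E} (hT : DifferentiableAt ℝ T x) (w a b c : E) :
    fderiv ℝ T x w a b c = fderiv ℝ (fun y => T y a b c) x w := by
  have h : HasFDerivAt (fun y => T y a b c) _ x :=
    ((hT.hasFDerivAt.clm_apply (hasFDerivAt_const a x)).clm_apply
      (hasFDerivAt_const b x)).clm_apply (hasFDerivAt_const c x)
  rw [h.fderiv]
  simp

lemma fderiv_formOfCoeff_apply {d : ℕ} {H : Fin d → Fin d → Fin d → (Fin d → ℝ) → ℝ}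
    {x : Fin d → ℝ} (hH : ∀ i j k, DifferentiableAt ℝ (H i j k) x) (a b c e : Fin d → ℝ) :
    fderiv ℝ (formOfCoeff H) x a b c e
      = ∑ i, ∑ j, ∑ k, ∑ l, a i * b j * c k * e l * pd i (H j k l) x := by
  have hT : DifferentiableAt ℝ (formOfCoeff H) x := by
    unfold formOfCoeff
    fun_prop
  have h_sum : HasFDerivAt (fun y => formOfCoeff H y b c e)
      (∑ i, ∑ j, ∑ k, (b i * (c j * e k)) • fderiv ℝ (H i j k) x) x := by
    simp only [formOfCoeff_apply]
    exact HasFDerivAt.fun_sum fun i _ => HasFDerivAt.fun_sum fun j _ => HasFDerivAt.fun_sum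
      fun k _ => (hH i j k).hasFDerivAt.mul_const _
  rw [fderiv_apply₃ hT, fderiv_apply_eq_sum_pd]
  refine Finset.sum_congr rfl fun i _ => ?_
  simp only [pd, h_sum.fderiv, sum_apply, smul_apply, smul_eq_mul, Finset.mul_sum]
  refine Finset.sum_congr rfl fun j _ => Finset.sum_congr rfl fun k _ =>
    Finset.sum_congr rfl fun l _ => ?_
  ring

/-- The exterior derivative of `H` vanishes as a 4-linear form if it does so in coordinates. -/
lemma fderiv_formOfCoeff_closed {d : ℕ} {H : Fin d → Fin d → Fin d → (Fin d → ℝ) → ℝ}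
    {x : Fin d → ℝ} (hH : ∀ i j k, DifferentiableAt ℝ (H i j k) x)
    (hc : ∀ i j k l : Fin d, pd i (H j k l) x - pd j (H i k l) x
      + pd k (H i j l) x - pd l (H i j k) x = 0) (a b c e : Fin d → ℝ) :
    fderiv ℝ (formOfCoeff H) x a b c e - fderiv ℝ (formOfCoeff H) x b a c e
      + fderiv ℝ (formOfCoeff H) x c a b e - fderiv ℝ (formOfCoeff H) x e a b c = 0 := by
  simp only [fderiv_formOfCoeff_apply hH]
  have h₂ : ∑ i, ∑ j, ∑ k, ∑ l, b i * a j * c k * e l * pd i (H j k l) x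
      = ∑ i, ∑ j, ∑ k, ∑ l, b j * a i * c k * e l * pd j (H i k l) x := Finset.sum_comm
  have h₃ : ∑ i, ∑ j, ∑ k, ∑ l, c i * a j * b k * e l * pd i (H j k l) x
      = ∑ i, ∑ j, ∑ k, ∑ l, c k * a i * b j * e l * pd k (H i j l) x := by
    rw [Finset.sum_comm]
    exact Finset.sum_congr rfl fun _ _ => Finset.sum_comm
  have h₄ : ∑ i, ∑ j, ∑ k, ∑ l, e i * a j * b k * c l * pd i (H j k l) x
      = ∑ i, ∑ j, ∑ k, ∑ l, e l * a i * b j * c k * pd l (H i j k) x := by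
    rw [Finset.sum_comm]
    refine Finset.sum_congr rfl fun _ _ => ?_
    rw [Finset.sum_comm]
    exact Finset.sum_congr rfl fun _ _ => Finset.sum_comm
  rw [h₂, h₃, h₄]
  simp only [← Finset.sum_sub_distrib, ← Finset.sum_add_distrib]
  refine Finset.sum_eq_zero fun i _ => Finset.sum_eq_zero fun j _ =>
    Finset.sum_eq_zero fun k _ => Finset.sum_eq_zero fun l _ => ?_
  linear_combination a i * b j * c k * e l * hc i j k l

lemma formOfCoeff_swap_left {d : ℕ} {H : Fin d → Fin d → Fin d → (Fin d → ℝ) → ℝ}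
    (hH : ∀ i j k x, H i j k x = - H j i k x) (x u v w : Fin d → ℝ) :
    formOfCoeff H x u v w = - formOfCoeff H x v u w := by
  simp only [formOfCoeff_apply, ← Finset.sum_neg_distrib]
  rw [Finset.sum_comm]
  refine Finset.sum_congr rfl fun i _ => Finset.sum_congr rfl fun j _ =>
    Finset.sum_congr rfl fun k _ => ?_
  rw [hH j i k]
  ring

lemma formOfCoeff_swap_right {d : ℕ} {H : Fin d → Fin d → Fin d → (Fin d → ℝ) → ℝ}
    (hH : ∀ i j k x, H i j k x = - H i k j x) (x u v w : Fin d → ℝ) :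
    formOfCoeff H x u v w = - formOfCoeff H x u w v := by
  simp only [formOfCoeff_apply, ← Finset.sum_neg_distrib]
  refine Finset.sum_congr rfl fun i _ => ?_
  rw [Finset.sum_comm]
  refine Finset.sum_congr rfl fun j _ => Finset.sum_congr rfl fun k _ => ?_
  rw [hH i k j]
  ring

lemma dorfman_fst {d : ℕ} (H : Fin d → Fin d → Fin d → (Fin d → ℝ) → ℝ) {e₁ e₂ : GVF d}
    (h₁ : Differentiable ℝ e₁.1) (h₂ : Differentiable ℝ e₂.1) :
    (dorfman H e₁ e₂).1 = VectorField.lieBracket ℝ e₁.1 e₂.1 := by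
  ext x i
  simp [dorfman, VectorField.lieBracket, fderiv_coord (h₁ x), fderiv_coord (h₂ x),
    Finset.sum_sub_distrib]

/-- The 1-form part of the Dorfman bracket, without coordinates: `B` pairs covectors with vectors
and `T` is the twisting 3-form. -/
noncomputable def dorfmanForm {E F : Type*} [NormedAddCommGroup E] [NormedSpace ℝ E]
    [NormedAddCommGroup F] [NormedSpace ℝ F] (B : F →L[ℝ] E →L[ℝ] ℝ)
    (T : E → E →L[ℝ] E →L[ℝ] E →L[ℝ] ℝ) (X : E → E) (α : E → F) (Y : E → E) (β : E → F)
    (x v : E) : ℝ :=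
  B (fderiv ℝ β x (X x)) v + B (β x) (fderiv ℝ X x v) - B (fderiv ℝ α x (Y x)) v
    + B (fderiv ℝ α x v) (Y x) + T x v (X x) (Y x)

lemma dotCLM_dorfman_snd {d : ℕ} (H : Fin d → Fin d → Fin d → (Fin d → ℝ) → ℝ) {e₁ e₂ : GVF d}
    (hX₁ : Differentiable ℝ e₁.1) (hα₁ : Differentiable ℝ e₁.2) (hα₂ : Differentiable ℝ e₂.2)
    (x v : Fin d → ℝ) :
    dotCLM d ((dorfman H e₁ e₂).2 x) v
      = dorfmanForm (dotCLM d) (formOfCoeff H) e₁.1 e₁.2 e₂.1 e₂.2 x v := by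
  have h₂ : ∑ i, ∑ j, e₂.2 x i * (v j * pd j (fun y => e₁.1 y i) x)
      = ∑ i, ∑ j, e₂.2 x j * (v i * pd i (fun y => e₁.1 y j) x) := Finset.sum_comm
  have h₄ : ∑ i, ∑ j, v j * pd j (fun y => e₁.2 y i) x * e₂.1 x i
      = ∑ i, ∑ j, v i * pd i (fun y => e₁.2 y j) x * e₂.1 x j := Finset.sum_comm
  simp only [dorfmanForm, dotCLM_apply, formOfCoeff_apply, fderiv_coord (hX₁ x),
    fderiv_coord (hα₁ x), fderiv_coord (hα₂ x), Finset.mul_sum, Finset.sum_mul, h₂, h₄, dorfman,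
    add_mul, ← Finset.sum_sub_distrib, ← Finset.sum_add_distrib]
  refine Finset.sum_congr rfl fun i _ => Finset.sum_congr rfl fun j _ => ?_
  congr 1
  · ring
  · exact Finset.sum_congr rfl fun k _ => by ring

lemma contDiff_pd {d : ℕ} {f : (Fin d → ℝ) → ℝ} (hf : ContDiff ℝ (⊤ : ℕ∞) f) (m : Fin d) :
    ContDiff ℝ (⊤ : ℕ∞) (pd m f) :=
  (hf.fderiv_right (m := (⊤ : ℕ∞)) (by simp)).clm_apply contDiff_const

lemma contDiff_dorfman {d : ℕ} {H : Fin d → Fin d → Fin d → (Fin d → ℝ) → ℝ}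
    (hH : ∀ i j k, ContDiff ℝ (⊤ : ℕ∞) (H i j k)) {e₁ e₂ : GVF d}
    (hX₁ : ContDiff ℝ (⊤ : ℕ∞) e₁.1) (hα₁ : ContDiff ℝ (⊤ : ℕ∞) e₁.2)
    (hX₂ : ContDiff ℝ (⊤ : ℕ∞) e₂.1) (hα₂ : ContDiff ℝ (⊤ : ℕ∞) e₂.2) :
    ContDiff ℝ (⊤ : ℕ∞) (dorfman H e₁ e₂).1 ∧ ContDiff ℝ (⊤ : ℕ∞) (dorfman H e₁ e₂).2 := by
  have hX₁' := contDiff_pi.1 hX₁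
  have hα₁' := contDiff_pi.1 hα₁
  have hX₂' := contDiff_pi.1 hX₂
  have hα₂' := contDiff_pi.1 hα₂
  have dX₁ := fun i j => contDiff_pd (hX₁' i) j
  have dα₁ := fun i j => contDiff_pd (hα₁' i) j
  have dX₂ := fun i j => contDiff_pd (hX₂' i) j
  have dα₂ := fun i j => contDiff_pd (hα₂' i) j
  constructor <;> refine contDiff_pi.2 fun i => ?_
  · exact ContDiff.sum (s := Finset.univ) fun j _ =>
      ((hX₁' j).mul (dX₂ i j)).sub ((hX₂' j).mul (dX₁ i j))
  · exact (ContDiff.sum fun j _ => ((((hX₁' j).mul (dα₂ i j)).add ((hα₂' j).mul (dX₁ j i))).sub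
      ((hX₂' j).mul (dα₁ i j))).add ((hX₂' j).mul (dα₁ j i))).add
      (ContDiff.sum fun j _ => ContDiff.sum fun k _ => ((hH i j k).mul (hX₁' j)).mul (hX₂' k))

lemma ContDiff.hasFDerivAt_fderiv {E F : Type*} [NormedAddCommGroup E] [NormedSpace ℝ E]
    [NormedAddCommGroup F] [NormedSpace ℝ F] {f : E → F} (hf : ContDiff ℝ 2 f) (x : E) :
    HasFDerivAt (fderiv ℝ f) (fderiv ℝ (fderiv ℝ f) x) x :=
  ((hf.fderiv_right (m := 1) (by norm_num)).differentiable (by norm_num) x).hasFDerivAt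

lemma ContDiff.fderiv_fderiv_comm {E F : Type*} [NormedAddCommGroup E] [NormedSpace ℝ E]
    [NormedAddCommGroup F] [NormedSpace ℝ F] {f : E → F} (hf : ContDiff ℝ 2 f) (x a b : E) :
    fderiv ℝ (fderiv ℝ f) x a b = fderiv ℝ (fderiv ℝ f) x b a :=
  (hf.contDiffAt.isSymmSndFDerivAt (by simp)).eq a b

lemma fderiv_dorfmanForm {E F : Type*} [NormedAddCommGroup E] [NormedSpace ℝ E]
    [NormedAddCommGroup F] [NormedSpace ℝ F] (B : F →L[ℝ] E →L[ℝ] ℝ)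
    {T : E → E →L[ℝ] E →L[ℝ] E →L[ℝ] ℝ} {X Y : E → E} {α β : E → F}
    (hT : Differentiable ℝ T) (hX : ContDiff ℝ 2 X) (hα : ContDiff ℝ 2 α)
    (hY : ContDiff ℝ 2 Y) (hβ : ContDiff ℝ 2 β) (x v w : E) :
    fderiv ℝ (fun y => dorfmanForm B T X α Y β y v) x w
      = B (fderiv ℝ (fderiv ℝ β) x w (X x)) v + B (fderiv ℝ β x (fderiv ℝ X x w)) v
        + B (fderiv ℝ β x w) (fderiv ℝ X x v) + B (β x) (fderiv ℝ (fderiv ℝ X) x w v)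
        - B (fderiv ℝ (fderiv ℝ α) x w (Y x)) v - B (fderiv ℝ α x (fderiv ℝ Y x w)) v
        + B (fderiv ℝ (fderiv ℝ α) x w v) (Y x) + B (fderiv ℝ α x v) (fderiv ℝ Y x w)
        + fderiv ℝ T x w v (X x) (Y x) + T x v (fderiv ℝ X x w) (Y x)
        + T x v (X x) (fderiv ℝ Y x w) := by
  have hc := fun (u : E) => hasFDerivAt_const (𝕜 := ℝ) u x
  have dX := (hX.differentiable two_ne_zero x).hasFDerivAt
  have dY := (hY.differentiable two_ne_zero x).hasFDerivAt
  have dβ := (hβ.differentiable two_ne_zero x).hasFDerivAt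
  have t₁ := (B.hasFDerivAt.comp x ((hβ.hasFDerivAt_fderiv x).clm_apply dX)).clm_apply (hc v)
  have t₂ := (B.hasFDerivAt.comp x dβ).clm_apply ((hX.hasFDerivAt_fderiv x).clm_apply (hc v))
  have t₃ := (B.hasFDerivAt.comp x ((hα.hasFDerivAt_fderiv x).clm_apply dY)).clm_apply (hc v)
  have t₄ := (B.hasFDerivAt.comp x ((hα.hasFDerivAt_fderiv x).clm_apply (hc v))).clm_apply dY
  have t₅ := (((hT x).hasFDerivAt.clm_apply (hc v)).clm_apply dX).clm_apply dY
  have h : HasFDerivAt (fun y => dorfmanForm B T X α Y β y v) _ x :=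
    (((t₁.add t₂).sub t₃).add t₄).add t₅
  rw [h.fderiv]
  simp
  ring

lemma fderiv_lieBracket_apply {E : Type*} [NormedAddCommGroup E] [NormedSpace ℝ E] {X Y : E → E}
    (hX : ContDiff ℝ 2 X) (hY : ContDiff ℝ 2 Y) (x w : E) :
    fderiv ℝ (VectorField.lieBracket ℝ X Y) x w
      = fderiv ℝ (fderiv ℝ Y) x w (X x) + fderiv ℝ Y x (fderiv ℝ X x w)
        - fderiv ℝ (fderiv ℝ X) x w (Y x) - fderiv ℝ X x (fderiv ℝ Y x w) := by
  have h : HasFDerivAt (VectorField.lieBracket ℝ X Y) _ x :=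
    ((hY.hasFDerivAt_fderiv x).clm_apply (hX.differentiable two_ne_zero x).hasFDerivAt).sub
      ((hX.hasFDerivAt_fderiv x).clm_apply (hY.differentiable two_ne_zero x).hasFDerivAt)
  rw [h.fderiv]
  simp
  abel

lemma clm_fderiv_apply_eq {E F : Type*} [NormedAddCommGroup E] [NormedSpace ℝ E]
    [NormedAddCommGroup F] [NormedSpace ℝ F] (B : F →L[ℝ] E →L[ℝ] ℝ) {γ : E → F} {x : E}
    (hγ : DifferentiableAt ℝ γ x) (v w : E) :
    B (fderiv ℝ γ x w) v = fderiv ℝ (fun y => B (γ y) v) x w := by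
  have h : HasFDerivAt (fun y => B (γ y) v) _ x :=
    (B.hasFDerivAt.comp x hγ.hasFDerivAt).clm_apply (hasFDerivAt_const v x)
  rw [h.fderiv]
  simp

set_option maxHeartbeats 800000 in
/-- The 1-form part of the Leibniz identity: `γ₁₂`, `γ₁₃`, `γ₂₃` are the 1-form parts of the
brackets, and the twisting form `T` is closed. -/
theorem dorfmanForm_leibniz {E F : Type*} [NormedAddCommGroup E] [NormedSpace ℝ E]
    [NormedAddCommGroup F] [NormedSpace ℝ F] (B : F →L[ℝ] E →L[ℝ] ℝ)
    {T : E → E →L[ℝ] E →L[ℝ] E →L[ℝ] ℝ} {X₁ X₂ X₃ : E → E} {α₁ α₂ α₃ γ₁₂ γ₁₃ γ₂₃ : E → F}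
    (hT : Differentiable ℝ T) (hT₁ : ∀ x u v w, T x u v w = - T x v u w)
    (hT₂ : ∀ x u v w, T x u v w = - T x u w v)
    (hX₁ : ContDiff ℝ 2 X₁) (hα₁ : ContDiff ℝ 2 α₁) (hX₂ : ContDiff ℝ 2 X₂)
    (hα₂ : ContDiff ℝ 2 α₂) (hX₃ : ContDiff ℝ 2 X₃) (hα₃ : ContDiff ℝ 2 α₃)
    (dγ₁₂ : Differentiable ℝ γ₁₂) (dγ₁₃ : Differentiable ℝ γ₁₃) (dγ₂₃ : Differentiable ℝ γ₂₃)
    (hγ₁₂ : ∀ x v, B (γ₁₂ x) v = dorfmanForm B T X₁ α₁ X₂ α₂ x v)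
    (hγ₁₃ : ∀ x v, B (γ₁₃ x) v = dorfmanForm B T X₁ α₁ X₃ α₃ x v)
    (hγ₂₃ : ∀ x v, B (γ₂₃ x) v = dorfmanForm B T X₂ α₂ X₃ α₃ x v) (x : E)
    (hc : ∀ a b c e, fderiv ℝ T x a b c e - fderiv ℝ T x b a c e + fderiv ℝ T x c a b e
      - fderiv ℝ T x e a b c = 0) (v : E) :
    dorfmanForm B T X₁ α₁ (VectorField.lieBracket ℝ X₂ X₃) γ₂₃ x v
      = dorfmanForm B T (VectorField.lieBracket ℝ X₁ X₂) γ₁₂ X₃ α₃ x v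
        + dorfmanForm B T X₂ α₂ (VectorField.lieBracket ℝ X₁ X₃) γ₁₃ x v := by
  have hDT₁ (w a b c : E) : fderiv ℝ T x w a b c = - fderiv ℝ T x w b a c := by
    rw [fderiv_apply₃ (hT x), fderiv_apply₃ (hT x), funext fun y => hT₁ y a b c, fderiv_fun_neg]
    rfl
  have hDT₂ (w a b c : E) : fderiv ℝ T x w a b c = - fderiv ℝ T x w a c b := by
    rw [fderiv_apply₃ (hT x), fderiv_apply₃ (hT x), funext fun y => hT₂ y a b c, fderiv_fun_neg]
    rfl
  rw [dorfmanForm, dorfmanForm, dorfmanForm]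
  simp only [clm_fderiv_apply_eq B (dγ₁₂ x), clm_fderiv_apply_eq B (dγ₁₃ x),
    clm_fderiv_apply_eq B (dγ₂₃ x), hγ₁₂, hγ₁₃, hγ₂₃,
    fderiv_dorfmanForm B hT hX₁ hα₁ hX₂ hα₂, fderiv_dorfmanForm B hT hX₁ hα₁ hX₃ hα₃,
    fderiv_dorfmanForm B hT hX₂ hα₂ hX₃ hα₃, fderiv_lieBracket_apply hX₁ hX₂]
  simp only [dorfmanForm, VectorField.lieBracket, map_add, map_sub, sub_apply]
  rw [hX₁.fderiv_fderiv_comm x v (X₂ x), hX₁.fderiv_fderiv_comm x v (X₃ x),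
    hX₂.fderiv_fderiv_comm x v, hα₁.fderiv_fderiv_comm x v, hα₁.fderiv_fderiv_comm x v,
    hα₂.fderiv_fderiv_comm x v,
    hα₁.fderiv_fderiv_comm x (X₂ x) (X₃ x), hα₂.fderiv_fderiv_comm x (X₁ x) (X₃ x),
    hα₃.fderiv_fderiv_comm x (X₁ x) (X₂ x)]
  linear_combination hc (X₁ x) v (X₂ x) (X₃ x) - hDT₁ v (X₃ x) (X₁ x) (X₂ x)
    + hDT₂ v (X₁ x) (X₃ x) (X₂ x) - hDT₁ (X₂ x) v (X₁ x) (X₃ x) + hDT₁ (X₃ x) v (X₁ x) (X₂ x)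
    - hT₁ x (X₃ x) (fderiv ℝ X₁ x v) (X₂ x) + hT₂ x (fderiv ℝ X₁ x v) (X₃ x) (X₂ x)
    - hT₁ x (X₃ x) (X₁ x) (fderiv ℝ X₂ x v) + hT₂ x (X₁ x) (X₃ x) (fderiv ℝ X₂ x v)
    - hT₁ x (X₁ x) (fderiv ℝ X₂ x v) (X₃ x) + hT₂ x v (X₂ x) (fderiv ℝ X₁ x (X₃ x))

theorem dorfman_leibniz_of_closed {d : ℕ} {H : Fin d → Fin d → Fin d → (Fin d → ℝ) → ℝ}
    (hH : ∀ i j k, ContDiff ℝ (⊤ : ℕ∞) (H i j k))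
    (hHanti₁ : ∀ i j k x, H i j k x = - H j i k x)
    (hHanti₂ : ∀ i j k x, H i j k x = - H i k j x)
    (hc : ∀ (i j k l : Fin d) (x : Fin d → ℝ), pd i (H j k l) x - pd j (H i k l) x
      + pd k (H i j l) x - pd l (H i j k) x = 0) {e₁ e₂ e₃ : GVF d}
    (hX₁ : ContDiff ℝ (⊤ : ℕ∞) e₁.1) (hα₁ : ContDiff ℝ (⊤ : ℕ∞) e₁.2)
    (hX₂ : ContDiff ℝ (⊤ : ℕ∞) e₂.1) (hα₂ : ContDiff ℝ (⊤ : ℕ∞) e₂.2)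
    (hX₃ : ContDiff ℝ (⊤ : ℕ∞) e₃.1) (hα₃ : ContDiff ℝ (⊤ : ℕ∞) e₃.2) :
    dorfman H e₁ (dorfman H e₂ e₃)
      = dorfman H (dorfman H e₁ e₂) e₃ + dorfman H e₂ (dorfman H e₁ e₃) := by
  obtain ⟨hX₁₂, hα₁₂⟩ := contDiff_dorfman hH hX₁ hα₁ hX₂ hα₂
  obtain ⟨hX₁₃, hα₁₃⟩ := contDiff_dorfman hH hX₁ hα₁ hX₃ hα₃
  obtain ⟨hX₂₃, hα₂₃⟩ := contDiff_dorfman hH hX₂ hα₂ hX₃ hα₃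
  have two_le : (2 : WithTop ℕ∞) ≤ ((⊤ : ℕ∞) : WithTop ℕ∞) :=
    WithTop.coe_le_coe.2 le_top
  have diff {f : (Fin d → ℝ) → Fin d → ℝ} (hf : ContDiff ℝ (⊤ : ℕ∞) f) : Differentiable ℝ f :=
    hf.differentiable (by simp)
  have hfst₁₂ := dorfman_fst H (diff hX₁) (diff hX₂)
  have hfst₁₃ := dorfman_fst H (diff hX₁) (diff hX₃)
  have hfst₂₃ := dorfman_fst H (diff hX₂) (diff hX₃)
  refine Prod.ext ?_ ?_
  · rw [Prod.fst_add, dorfman_fst H (diff hX₁) (diff hX₂₃), dorfman_fst H (diff hX₁₂) (diff hX₃),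
      dorfman_fst H (diff hX₂) (diff hX₁₃), hfst₁₂, hfst₁₃, hfst₂₃]
    funext x
    exact VectorField.leibniz_identity_lieBracket (n := 2) (by simp) (hX₁.of_le two_le).contDiffAt
      (hX₂.of_le two_le).contDiffAt (hX₃.of_le two_le).contDiffAt
  · funext x i
    rw [Prod.snd_add, Pi.add_apply, Pi.add_apply,
      ← dotCLM_single ((dorfman H e₁ (dorfman H e₂ e₃)).2 x),
      ← dotCLM_single ((dorfman H (dorfman H e₁ e₂) e₃).2 x),
      ← dotCLM_single ((dorfman H e₂ (dorfman H e₁ e₃)).2 x),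
      dotCLM_dorfman_snd H (diff hX₁) (diff hα₁) (diff hα₂₃),
      dotCLM_dorfman_snd H (diff hX₁₂) (diff hα₁₂) (diff hα₃),
      dotCLM_dorfman_snd H (diff hX₂) (diff hα₂) (diff hα₁₃), hfst₁₂, hfst₁₃, hfst₂₃]
    exact dorfmanForm_leibniz (dotCLM d) ((contDiff_formOfCoeff hH).differentiable (by simp))
      (formOfCoeff_swap_left hHanti₁) (formOfCoeff_swap_right hHanti₂)
      (hX₁.of_le two_le) (hα₁.of_le two_le) (hX₂.of_le two_le) (hα₂.of_le two_le)
      (hX₃.of_le two_le) (hα₃.of_le two_le) (diff hα₁₂) (diff hα₁₃) (diff hα₂₃)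
      (dotCLM_dorfman_snd H (diff hX₁) (diff hα₁) (diff hα₂))
      (dotCLM_dorfman_snd H (diff hX₁) (diff hα₁) (diff hα₃))
      (dotCLM_dorfman_snd H (diff hX₂) (diff hα₂) (diff hα₃)) x
      (fderiv_formOfCoeff_closed (fun i j k => (hH i j k).differentiable (by simp) x)
        fun i j k l => hc i j k l x) _

lemma pd_const {d : ℕ} (m : Fin d) (c : ℝ) (x : Fin d → ℝ) : pd m (fun _ => c) x = 0 := by
  simp [pd]

lemma pd_neg {d : ℕ} (m : Fin d) (f : (Fin d → ℝ) → ℝ) (x : Fin d → ℝ) :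
    pd m (fun y => - f y) x = - pd m f x := by
  simp [pd, fderiv_fun_neg]

lemma dorfman_coordinate_fields {d : ℕ} (H : Fin d → Fin d → Fin d → (Fin d → ℝ) → ℝ)
    (b c : Fin d) :
    dorfman H (fun _ => Pi.single b 1, 0) (fun _ => Pi.single c 1, 0)
      = (0, fun x i => H i b c x) := by
  ext x i <;> simp [dorfman, pd_const, Pi.single_apply]

lemma dorfman_coordinate_left {d : ℕ} (H : Fin d → Fin d → Fin d → (Fin d → ℝ) → ℝ)
    (a i : Fin d) (β : (Fin d → ℝ) → Fin d → ℝ) (x : Fin d → ℝ) :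
    (dorfman H (fun _ => Pi.single a 1, 0) (0, β)).2 x i = pd a (fun y => β y i) x := by
  simp [dorfman, pd_const, Pi.single_apply]

lemma dorfman_coordinate_right {d : ℕ} (H : Fin d → Fin d → Fin d → (Fin d → ℝ) → ℝ)
    (c i : Fin d) (β : (Fin d → ℝ) → Fin d → ℝ) (x : Fin d → ℝ) :
    (dorfman H (0, β) (fun _ => Pi.single c 1, 0)).2 x i
      = pd i (fun y => β y c) x - pd c (fun y => β y i) x := by
  simp [dorfman, pd_const, Pi.single_apply, Finset.sum_add_distrib]
  ring

end Auxiliary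

/-- The `H`-twisted Dorfman bracket satisfies the Leibniz identity on all smooth generalized
vector fields iff the 3-form `H` is closed (the first Courant algebroid axiom for the
`H`-twisted standard Courant algebroid on `ℝ^d`). -/
theorem dorfman_leibniz_iff_closed {d : ℕ}
    (H : Fin d → Fin d → Fin d → (Fin d → ℝ) → ℝ)
    (hH : ∀ i j k, ContDiff ℝ (⊤ : ℕ∞) (H i j k))
    (hHanti₁ : ∀ i j k x, H i j k x = - H j i k x)
    (hHanti₂ : ∀ i j k x, H i j k x = - H i k j x) :
    (∀ e₁ e₂ e₃ : GVF d,
        ContDiff ℝ (⊤ : ℕ∞) e₁.1 → ContDiff ℝ (⊤ : ℕ∞) e₁.2 →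
        ContDiff ℝ (⊤ : ℕ∞) e₂.1 → ContDiff ℝ (⊤ : ℕ∞) e₂.2 →
        ContDiff ℝ (⊤ : ℕ∞) e₃.1 → ContDiff ℝ (⊤ : ℕ∞) e₃.2 →
        dorfman H e₁ (dorfman H e₂ e₃)
          = dorfman H (dorfman H e₁ e₂) e₃ + dorfman H e₂ (dorfman H e₁ e₃))
      ↔ (∀ (i j k l : Fin d) (x : Fin d → ℝ),
          pd i (fun y => H j k l y) x - pd j (fun y => H i k l y) x
            + pd k (fun y => H i j l y) x - pd l (fun y => H i j k y) x = 0) := by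
  constructor
  · intro h i j k l x
    have key := congrFun (congrFun (congrArg Prod.snd
      (h (fun _ => Pi.single i 1, 0) (fun _ => Pi.single k 1, 0) (fun _ => Pi.single l 1, 0)
        contDiff_const contDiff_const contDiff_const contDiff_const contDiff_const
        contDiff_const)) x) j
    simp only [dorfman_coordinate_fields, Prod.snd_add, Pi.add_apply, dorfman_coordinate_left,
      dorfman_coordinate_right] at key
    rw [funext fun y => hHanti₁ l i k y, funext fun y => hHanti₂ i l k y,
      funext fun y => hHanti₁ j i k y, funext fun y => hHanti₁ j i l y] at key
    simp only [pd_neg] at key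
    linear_combination key
  · intro hc e₁ e₂ e₃ hX₁ hα₁ hX₂ hα₂ hX₃ hα₃
    exact dorfman_leibniz_of_closed hH hHanti₁ hHanti₂ hc hX₁ hα₁ hX₂ hα₂ hX₃ hα₃
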